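/- arXiv:2510.27391 — 6 statements merged into one kernel-verified Lean document; each statement's English description precedes it below -/
import Mathlib

section
/- Let 0 < c_min < c₁ < c₂, set M := √c₂ − √c₁, M_min := √c₂ − √c_min, L := √c₁ − √c_min, r_min := max{ 1/√c₁, 2/L, (1/L)·log(12·√c₁/(c_min^{3/2}·L²)) }, and r_min* := max{ r_min, 1/√c₂, 2/M_min, (1/M_min)·log(12·√c₂/(c_min^{3/2}·M_min²)) }. If r ≥ max{ r_min*, 4/M, 3/√c₂ }, then the function J(c₃) := D(c₁, c₃; r) + D(c₂, c₃; r) has a unique minimizer on the interval [c₁, c₂]: there exists a unique c₃* ∈ [c₁, c₂] such that J(c₃*) < J(c₃) for every c₃ ∈ [c₁, c₂] with c₃ ≠ c₃*. -/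
/-- The hyperbolic manifold distance
`D(c₁, c₃; r) = (−√c₁ + 2·√c₃·cosh((√c₃ − √c₁)·r)) / (2·√c₁·c₃)`. -/
noncomputable def D (c₁ r c₃ : ℝ) : ℝ :=
  (-Real.sqrt c₁ + 2 * Real.sqrt c₃ * Real.cosh ((Real.sqrt c₃ - Real.sqrt c₁) * r)) /
    (2 * Real.sqrt c₁ * c₃)

/-- The summand `cosh ((s - a) r) / (a s)` of the distance, in the variable `t = 1 / s`. -/
noncomputable def coshTerm (a r t : ℝ) : ℝ := t * Real.cosh ((t⁻¹ - a) * r) / a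

/-- The first derivative of `coshTerm` in `t`. -/
noncomputable def coshTermDeriv (a r t : ℝ) : ℝ :=
  (Real.cosh ((t⁻¹ - a) * r) - r * t⁻¹ * Real.sinh ((t⁻¹ - a) * r)) / a

theorem hasDerivAt_inv_sub_mul (a r : ℝ) {t : ℝ} (ht : t ≠ 0) :
    HasDerivAt (fun x : ℝ => (x⁻¹ - a) * r) (-(t ^ 2)⁻¹ * r) t :=
  ((hasDerivAt_inv ht).sub_const a).mul_const r

theorem hasDerivAt_coshTerm (a r : ℝ) {t : ℝ} (ht : t ≠ 0) :
    HasDerivAt (coshTerm a r) (coshTermDeriv a r t) t := by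
  have h := ((hasDerivAt_id t).mul (hasDerivAt_inv_sub_mul a r ht).cosh).div_const a
  refine h.congr_deriv ?_
  simp only [coshTermDeriv, id]
  congr 1
  field_simp
  ring

theorem hasDerivAt_coshTermDeriv (a r : ℝ) {t : ℝ} (ht : t ≠ 0) :
    HasDerivAt (coshTermDeriv a r) (r ^ 2 * t⁻¹ ^ 3 * Real.cosh ((t⁻¹ - a) * r) / a) t := by
  have h := ((hasDerivAt_inv_sub_mul a r ht).cosh.sub
    (((hasDerivAt_inv ht).const_mul r).mul (hasDerivAt_inv_sub_mul a r ht).sinh)).div_const a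
  refine h.congr_deriv ?_
  congr 1
  field_simp
  ring

theorem strictConvexOn_coshTerm_add_sub_sq {a b r : ℝ} (ha : 0 < a) (hb : 0 < b)
    (har : 2 < (a * r) ^ 2) :
    StrictConvexOn ℝ (Set.Icc b⁻¹ a⁻¹) fun t => coshTerm a r t + coshTerm b r t - t ^ 2 := by
  have hderiv : ∀ t : ℝ, 0 < t → HasDerivAt
      (fun t => coshTerm a r t + coshTerm b r t - t ^ 2)
      (coshTermDeriv a r t + coshTermDeriv b r t - 2 * t) t := by
    intro t ht
    refine (((hasDerivAt_coshTerm a r ht.ne').add (hasDerivAt_coshTerm b r ht.ne')).sub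
      (hasDerivAt_pow 2 t)).congr_deriv ?_
    simp
  have hpos : ∀ t ∈ Set.Icc b⁻¹ a⁻¹, 0 < t := fun t ht => (inv_pos.2 hb).trans_le ht.1
  refine strictConvexOn_of_deriv2_pos (convex_Icc _ _)
    (fun t ht => (hderiv t (hpos t ht)).continuousAt.continuousWithinAt) fun t ht => ?_
  have htI := interior_subset ht
  have ht0 := hpos t htI
  have hev : deriv (fun t => coshTerm a r t + coshTerm b r t - t ^ 2) =ᶠ[nhds t]
      fun t => coshTermDeriv a r t + coshTermDeriv b r t - 2 * t := by
    filter_upwards [lt_mem_nhds ht0] with x hx using (hderiv x hx).deriv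
  have h2 := ((hasDerivAt_coshTermDeriv a r ht0.ne').add
    (hasDerivAt_coshTermDeriv b r ht0.ne')).sub ((hasDerivAt_id t).const_mul 2)
  have hsecond : deriv (deriv fun t => coshTerm a r t + coshTerm b r t - t ^ 2) t = _ :=
    hev.deriv_eq.trans h2.deriv
  simp only [Function.iterate_succ, Function.iterate_zero, Function.comp_apply, id]
  rw [hsecond]
  have hat : a ≤ t⁻¹ := (le_inv_comm₀ ht0 ha).1 htI.2
  have hmain : (a * r) ^ 2 ≤ r ^ 2 * t⁻¹ ^ 3 * Real.cosh ((t⁻¹ - a) * r) / a := by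
    rw [le_div_iff₀ ha]
    calc (a * r) ^ 2 * a = r ^ 2 * a ^ 3 * 1 := by ring
      _ ≤ r ^ 2 * t⁻¹ ^ 3 * Real.cosh ((t⁻¹ - a) * r) := by
        gcongr
        exact Real.one_le_cosh _
  have hother : 0 ≤ r ^ 2 * t⁻¹ ^ 3 * Real.cosh ((t⁻¹ - b) * r) / b := by positivity
  linarith

theorem D_add_D_eq {c₁ c₂ c r : ℝ} (h1 : 0 < c₁) (h2 : 0 < c₂) (hc : 0 < c) :
    D c₁ r c + D c₂ r c = coshTerm (√c₁) r (√c)⁻¹ + coshTerm (√c₂) r (√c)⁻¹ - (√c)⁻¹ ^ 2 := by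
  have ha := Real.sqrt_pos.2 h1
  have hb := Real.sqrt_pos.2 h2
  have hs := Real.sqrt_pos.2 hc
  have hsq : c = √c ^ 2 := (Real.sq_sqrt hc.le).symm
  simp only [D, coshTerm, inv_inv]
  generalize √c = s at *
  subst hsq
  field_simp
  ring

/-- A strictly convex continuous function on a compact interval, precomposed with `c ↦ (√c)⁻¹`,
has a unique strict minimizer. -/
theorem existsUnique_strict_min_comp_inv_sqrt {f : ℝ → ℝ} {c₁ c₂ : ℝ} (h1 : 0 < c₁)
    (h2 : c₁ ≤ c₂) (hf : StrictConvexOn ℝ (Set.Icc (√c₂)⁻¹ (√c₁)⁻¹) f)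
    (hcont : ContinuousOn (fun c => f (√c)⁻¹) (Set.Icc c₁ c₂)) :
    ∃! c₀ : ℝ, c₀ ∈ Set.Icc c₁ c₂ ∧
      ∀ c ∈ Set.Icc c₁ c₂, c ≠ c₀ → f (√c₀)⁻¹ < f (√c)⁻¹ := by
  have hmaps : ∀ c ∈ Set.Icc c₁ c₂, (√c)⁻¹ ∈ Set.Icc (√c₂)⁻¹ (√c₁)⁻¹ := fun c hc =>
    ⟨inv_anti₀ (Real.sqrt_pos.2 (h1.trans_le hc.1)) (Real.sqrt_le_sqrt hc.2),
      inv_anti₀ (Real.sqrt_pos.2 h1) (Real.sqrt_le_sqrt hc.1)⟩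
  have hsurj : ∀ t ∈ Set.Icc (√c₂)⁻¹ (√c₁)⁻¹, ∃ c ∈ Set.Icc c₁ c₂, (√c)⁻¹ = t := by
    intro t ht
    have hb : 0 < √c₂ := Real.sqrt_pos.2 (h1.trans_le h2)
    have ha : 0 < √c₁ := Real.sqrt_pos.2 h1
    have ht0 : 0 < t := (inv_pos.2 hb).trans_le ht.1
    refine ⟨t⁻¹ ^ 2, ⟨?_, ?_⟩, ?_⟩
    · exact (Real.sqrt_le_left (by positivity)).1 ((le_inv_comm₀ ht0 ha).1 ht.2)
    · exact (Real.le_sqrt' (by positivity)).1 ((inv_le_comm₀ hb ht0).1 ht.1)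
    · rw [Real.sqrt_sq (by positivity), inv_inv]
  obtain ⟨c₀, hc₀, hmin⟩ := isCompact_Icc.exists_isMinOn (Set.nonempty_Icc.2 h2) hcont
  have hminf : IsMinOn f (Set.Icc (√c₂)⁻¹ (√c₁)⁻¹) (√c₀)⁻¹ := by
    intro t ht
    obtain ⟨c, hc, rfl⟩ := hsurj t ht
    exact hmin hc
  refine ⟨c₀, ⟨hc₀, fun c hc hne => ?_⟩, fun c' ⟨hc', hlt⟩ => ?_⟩
  · refine lt_of_le_of_ne (hmin hc) fun heq => hne ?_
    have hminc : IsMinOn f (Set.Icc (√c₂)⁻¹ (√c₁)⁻¹) (√c)⁻¹ := fun t ht =>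
      heq.symm.le.trans (hminf ht)
    exact (Real.sqrt_inj (h1.le.trans hc.1) (h1.le.trans hc₀.1)).1
      (inv_injective (hf.eq_of_isMinOn hminc hminf (hmaps c hc) (hmaps c₀ hc₀)))
  · by_contra hne
    exact (hlt c₀ hc₀ (Ne.symm hne)).not_ge (hmin hc')

theorem stmt_3 (cmin c₁ c₂ r M Mmin L rmin rminStar : ℝ)
    (hcmin : 0 < cmin) (h1 : cmin < c₁) (h2 : c₁ < c₂)
    (hM : M = Real.sqrt c₂ - Real.sqrt c₁)
    (hMmin : Mmin = Real.sqrt c₂ - Real.sqrt cmin)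
    (hL : L = Real.sqrt c₁ - Real.sqrt cmin)
    (hrmin : rmin = max (max (1 / Real.sqrt c₁) (2 / L))
      ((1 / L) * Real.log (12 * Real.sqrt c₁ / ((cmin * Real.sqrt cmin) * L ^ 2))))
    (hrminStar : rminStar = max rmin (max (max (1 / Real.sqrt c₂) (2 / Mmin))
      ((1 / Mmin) * Real.log (12 * Real.sqrt c₂ / ((cmin * Real.sqrt cmin) * Mmin ^ 2)))))
    (hr : r ≥ max rminStar (max (4 / M) (3 / Real.sqrt c₂))) :
    ∃! c₃star : ℝ, c₃star ∈ Set.Icc c₁ c₂ ∧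
      ∀ c₃ ∈ Set.Icc c₁ c₂, c₃ ≠ c₃star →
        D c₁ r c₃star + D c₂ r c₃star < D c₁ r c₃ + D c₂ r c₃ := by
  have hc₁ : 0 < c₁ := hcmin.trans h1
  have hc₂ : 0 < c₂ := hc₁.trans h2
  have ha : 0 < √c₁ := Real.sqrt_pos.2 hc₁
  have hm : 0 < √cmin := Real.sqrt_pos.2 hcmin
  have hLpos : 0 < L := by
    rw [hL]
    exact sub_pos.2 (Real.sqrt_lt_sqrt hcmin.le h1)
  have hrL : 2 / L ≤ r := by
    refine le_trans ?_ hr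
    rw [hrminStar, hrmin]
    exact le_max_of_le_left (le_max_of_le_left (le_max_of_le_left (le_max_right _ _)))
  have hr0 : 0 < r := (div_pos two_pos hLpos).trans_le hrL
  have har : 2 < √c₁ * r := by
    have := (div_le_iff₀ hLpos).1 hrL
    have := mul_pos hm hr0
    rw [hL] at *
    linarith
  have hconv := strictConvexOn_coshTerm_add_sub_sq ha (Real.sqrt_pos.2 hc₂)
    (by nlinarith : 2 < (√c₁ * r) ^ 2)
  have hcont : ContinuousOn (fun c => coshTerm (√c₁) r (√c)⁻¹ + coshTerm (√c₂) r (√c)⁻¹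
      - (√c)⁻¹ ^ 2) (Set.Icc c₁ c₂) := by
    have hinv : ContinuousOn (fun c : ℝ => (√c)⁻¹) (Set.Icc c₁ c₂) :=
      Real.continuous_sqrt.continuousOn.inv₀ fun c hc =>
        (Real.sqrt_pos.2 (hc₁.trans_le hc.1)).ne'
    simp only [coshTerm, inv_inv]
    fun_prop
  have hD : ∀ c ∈ Set.Icc c₁ c₂, D c₁ r c + D c₂ r c =
      coshTerm (√c₁) r (√c)⁻¹ + coshTerm (√c₂) r (√c)⁻¹ - (√c)⁻¹ ^ 2 := fun c hc =>
    D_add_D_eq hc₁ hc₂ (hc₁.trans_le hc.1)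
  refine (existsUnique_congr fun c₀ => ?_).1
    (existsUnique_strict_min_comp_inv_sqrt hc₁ h2.le hconv hcont)
  refine and_congr_right fun hc₀ => forall₃_congr fun c hc _ => ?_
  rw [hD c₀ hc₀, hD c hc]
end

section
/- For all c₁ > 0 and r > 0, the derivative of the function c₃ ↦ D(c₁, c₃; r) evaluated at c₃ = c₁ equals 0; that is, c₃ = c₁ is a critical point of c₃ ↦ D(c₁, c₃; r). -/
theorem stmt_5 (c₁ r : ℝ) (hc₁ : 0 < c₁) (hr : 0 < r) :
    deriv (fun c₃ => D c₁ r c₃) c₁ = 0 := by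
  have hs : 0 < Real.sqrt c₁ := Real.sqrt_pos.mpr hc₁
  have hsqrt := Real.hasDerivAt_sqrt hc₁.ne'
  have hcosh := ((hsqrt.sub_const (Real.sqrt c₁)).mul_const r).cosh
  have hnum := ((hsqrt.const_mul 2).mul hcosh).const_add (-Real.sqrt c₁)
  have hden := (hasDerivAt_id c₁).const_mul (2 * Real.sqrt c₁)
  have hD : HasDerivAt (fun c₃ => D c₁ r c₃) _ c₁ :=
    hnum.div hden (mul_pos (mul_pos two_pos hs) hc₁).ne'
  rw [hD.deriv]
  simp only [Pi.mul_apply, sub_self, zero_mul, Real.cosh_zero, Real.sinh_zero]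
  field_simp
  rw [Real.sq_sqrt hc₁.le]
  ring
end

section
/- For all c₁ > 0, r > 0 and c₃ > 0, the second derivative of the function c₃ ↦ D(c₁, c₃; r) at c₃ equals N(c₃) / (4·√c₁·c₃³). -/
/-- `N(c₃) = √c₃·(3 + r²·c₃)·cosh(r·(√c₃ − √c₁)) − 3·c₃·r·sinh(r·(√c₃ − √c₁)) − 4·√c₁`. -/
noncomputable def N (c₁ r c₃ : ℝ) : ℝ :=
  Real.sqrt c₃ * (3 + r ^ 2 * c₃) * Real.cosh (r * (Real.sqrt c₃ - Real.sqrt c₁)) -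
    3 * c₃ * r * Real.sinh (r * (Real.sqrt c₃ - Real.sqrt c₁)) - 4 * Real.sqrt c₁

/-- The first derivative of `D c₁ r` at a positive point. -/
theorem hasDerivAt_D {c₁ x : ℝ} (r : ℝ) (hc₁ : 0 < c₁) (hx : 0 < x) :
    HasDerivAt (D c₁ r)
      (1 / (2 * x ^ 2) + r * Real.sinh ((√x - √c₁) * r) / (2 * √c₁ * x) -
        Real.cosh ((√x - √c₁) * r) / (2 * √c₁ * (x * √x))) x := by
  have ha : 0 < √c₁ := Real.sqrt_pos.2 hc₁
  have hs : 0 < √x := Real.sqrt_pos.2 hx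
  have hsqrt := Real.hasDerivAt_sqrt hx.ne'
  have hcosh := ((hsqrt.sub_const (√c₁)).mul_const r).cosh
  have h := (((hsqrt.const_mul 2).mul hcosh).const_add (-√c₁)).div
    ((hasDerivAt_id x).const_mul (2 * √c₁)) (by simp only [id]; positivity)
  refine h.congr_deriv ?_
  simp only [id, Pi.mul_apply]
  generalize Real.cosh ((√x - √c₁) * r) = C
  generalize Real.sinh ((√x - √c₁) * r) = S
  have hxs : x = √x ^ 2 := (Real.sq_sqrt hx.le).symm
  generalize √x = s at *
  subst hxs
  field_simp
  ring

/-- The derivative of the closed form of the first derivative of `D c₁ r`. -/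
theorem hasDerivAt_deriv_D {c₁ x : ℝ} (r : ℝ) (hc₁ : 0 < c₁) (hx : 0 < x) :
    HasDerivAt (fun y => 1 / (2 * y ^ 2) + r * Real.sinh ((√y - √c₁) * r) / (2 * √c₁ * y) -
        Real.cosh ((√y - √c₁) * r) / (2 * √c₁ * (y * √y)))
      (N c₁ r x / (4 * √c₁ * x ^ 3)) x := by
  have ha : 0 < √c₁ := Real.sqrt_pos.2 hc₁
  have hs : 0 < √x := Real.sqrt_pos.2 hx
  have hsqrt := Real.hasDerivAt_sqrt hx.ne'
  have harg := (hsqrt.sub_const (√c₁)).mul_const r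
  have h₁ := (hasDerivAt_const x (1 : ℝ)).fun_div ((hasDerivAt_pow 2 x).const_mul 2)
    (by positivity)
  have h₂ := (harg.sinh.const_mul r).fun_div ((hasDerivAt_id' x).const_mul (2 * √c₁))
    (by positivity)
  have h₃ := harg.cosh.fun_div (((hasDerivAt_id' x).fun_mul hsqrt).const_mul (2 * √c₁))
    (by positivity)
  refine ((h₁.fun_add h₂).fun_sub h₃).congr_deriv ?_
  rw [N, mul_comm r (√x - √c₁)]
  generalize Real.cosh ((√x - √c₁) * r) = C
  generalize Real.sinh ((√x - √c₁) * r) = S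
  have hxs : x = √x ^ 2 := (Real.sq_sqrt hx.le).symm
  generalize √x = s at *
  subst hxs
  field_simp
  ring

theorem stmt_6 (c₁ r c₃ : ℝ) (hc₁ : 0 < c₁) (hr : 0 < r) (hc₃ : 0 < c₃) :
    deriv (deriv (fun c₃ => D c₁ r c₃)) c₃ = N c₁ r c₃ / (4 * Real.sqrt c₁ * c₃ ^ 3) := by
  have h : deriv (fun c₃ => D c₁ r c₃) =ᶠ[nhds c₃] _ :=
    (lt_mem_nhds hc₃).mono fun y hy => (hasDerivAt_D r hc₁ hy).deriv
  rw [h.deriv_eq]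
  exact (hasDerivAt_deriv_D r hc₁ hc₃).deriv
end

section
/- For all c₁ > 0 and r > 0, the second derivative of the function c₃ ↦ D(c₁, c₃; r) evaluated at c₃ = c₁ equals (c₁·r² − 1) / (4·c₁³); in particular it is strictly positive whenever r > 1/√c₁. -/
theorem hasDerivAt_cosh_sqrt_sub (a r : ℝ) {x : ℝ} (hx : 0 < x) :
    HasDerivAt (fun y => Real.cosh ((Real.sqrt y - a) * r))
      (Real.sinh ((Real.sqrt x - a) * r) * (1 / (2 * Real.sqrt x) * r)) x :=
  (((Real.hasDerivAt_sqrt hx.ne').sub_const a).mul_const r).cosh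

theorem hasDerivAt_sinh_sqrt_sub (a r : ℝ) {x : ℝ} (hx : 0 < x) :
    HasDerivAt (fun y => Real.sinh ((Real.sqrt y - a) * r))
      (Real.cosh ((Real.sqrt x - a) * r) * (1 / (2 * Real.sqrt x) * r)) x :=
  (((Real.hasDerivAt_sqrt hx.ne').sub_const a).mul_const r).sinh

/-- The first derivative of `D c₁ r` on the positive half-line. -/
noncomputable def derivD (c₁ r x : ℝ) : ℝ :=
  1 / (2 * x ^ 2) +
    (r * Real.sqrt x * Real.sinh ((Real.sqrt x - Real.sqrt c₁) * r) -
      Real.cosh ((Real.sqrt x - Real.sqrt c₁) * r)) / (2 * Real.sqrt c₁ * (x * Real.sqrt x))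

theorem hasDerivAt_D_s7 {c₁ x : ℝ} (r : ℝ) (hc₁ : 0 < c₁) (hx : 0 < x) :
    HasDerivAt (D c₁ r) (derivD c₁ r x) x := by
  have ha : 0 < Real.sqrt c₁ := Real.sqrt_pos.2 hc₁
  have hs : 0 < Real.sqrt x := Real.sqrt_pos.2 hx
  have h := (((((Real.hasDerivAt_sqrt hx.ne').const_mul 2).mul
    (hasDerivAt_cosh_sqrt_sub (Real.sqrt c₁) r hx)).const_add (-Real.sqrt c₁)).div
    ((hasDerivAt_id x).const_mul (2 * Real.sqrt c₁)) (mul_pos (mul_pos two_pos ha) hx).ne')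
  refine h.congr_deriv ?_
  have hxs : x = Real.sqrt x ^ 2 := (Real.sq_sqrt hx.le).symm
  simp only [derivD, id, Pi.mul_apply]
  generalize Real.sinh _ = S
  generalize Real.cosh _ = C
  generalize Real.sqrt x = s at *
  subst hxs
  field_simp
  ring

theorem hasDerivAt_derivD {c : ℝ} (r : ℝ) (hc : 0 < c) :
    HasDerivAt (derivD c r) ((c * r ^ 2 - 1) / (4 * c ^ 3)) c := by
  have ha : 0 < Real.sqrt c := Real.sqrt_pos.2 hc
  have hsqrt := Real.hasDerivAt_sqrt hc.ne'
  have h₁ := (hasDerivAt_const c (1 : ℝ)).div ((hasDerivAt_pow 2 c).const_mul 2)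
    (by positivity)
  have h₂ := (((hsqrt.const_mul r).mul (hasDerivAt_sinh_sqrt_sub (Real.sqrt c) r hc)).sub
    (hasDerivAt_cosh_sqrt_sub (Real.sqrt c) r hc)).div
    (((hasDerivAt_id c).mul hsqrt).const_mul (2 * Real.sqrt c))
    (mul_pos (mul_pos two_pos ha) (mul_pos hc ha)).ne'
  refine (h₁.add h₂).congr_deriv ?_
  have hcs : c = Real.sqrt c ^ 2 := (Real.sq_sqrt hc.le).symm
  simp only [id, Pi.mul_apply, Pi.sub_apply, sub_self, zero_mul, Real.sinh_zero, Real.cosh_zero]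
  generalize Real.sqrt c = s at *
  subst hcs
  field_simp
  ring

theorem stmt_7 (c₁ r : ℝ) (hc₁ : 0 < c₁) (hr : 0 < r) :
    deriv (deriv (fun c₃ => D c₁ r c₃)) c₁ = (c₁ * r ^ 2 - 1) / (4 * c₁ ^ 3) ∧
      (r > 1 / Real.sqrt c₁ → 0 < deriv (deriv (fun c₃ => D c₁ r c₃)) c₁) := by
  have hderiv : deriv (deriv (fun c₃ => D c₁ r c₃)) c₁ = (c₁ * r ^ 2 - 1) / (4 * c₁ ^ 3) := by
    have hev : deriv (fun c₃ => D c₁ r c₃) =ᶠ[nhds c₁] derivD c₁ r := by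
      filter_upwards [lt_mem_nhds hc₁] with x hx using (hasDerivAt_D_s7 r hc₁ hx).deriv
    rw [hev.deriv_eq, (hasDerivAt_derivD r hc₁).deriv]
  refine ⟨hderiv, fun h => ?_⟩
  rw [hderiv]
  have h₁ : 1 < r * Real.sqrt c₁ := (div_lt_iff₀ (Real.sqrt_pos.2 hc₁)).1 h
  have h₂ : 1 < c₁ * r ^ 2 := by
    nlinarith [Real.sq_sqrt hc₁.le]
  exact div_pos (sub_pos.2 h₂) (by positivity)
end

section
/- Let 0 < c_min < c₁, set L := √c₁ − √c_min, and let r > 0 satisfy r·L ≥ 2. Then N(c_min) ≥ (1/3)·(√c_min·(3 + r²·c_min) + 3·c_min·r)·exp(r·L) − 4·√c₁ ≥ (1/3)·c_min^{3/2}·r²·exp(r·L) − 4·√c₁; consequently N(c_min) > 0 whenever in addition c_min^{3/2}·r²·exp(r·L) > 12·√c₁. -/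
/-- For `t ≥ 2`, `sinh t` is at least a third of `exp t`. -/
theorem exp_div_three_le_sinh {t : ℝ} (ht : 2 ≤ t) : Real.exp t / 3 ≤ Real.sinh t := by
  have h_exp : 3 ≤ Real.exp t := by linarith [Real.add_one_le_exp t]
  have h_neg : Real.exp (-t) ≤ 1 := Real.exp_le_one_iff.2 (by linarith)
  rw [Real.sinh_eq]
  linarith

theorem stmt_10 (cmin c₁ r L : ℝ) (hcmin : 0 < cmin) (hc : cmin < c₁)
    (hL : L = Real.sqrt c₁ - Real.sqrt cmin) (hr : 0 < r) (hrL : r * L ≥ 2) :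
    N c₁ r cmin ≥
        (1 / 3) * (Real.sqrt cmin * (3 + r ^ 2 * cmin) + 3 * cmin * r) * Real.exp (r * L) -
          4 * Real.sqrt c₁ ∧
      (1 / 3) * (Real.sqrt cmin * (3 + r ^ 2 * cmin) + 3 * cmin * r) * Real.exp (r * L) -
          4 * Real.sqrt c₁ ≥
        (1 / 3) * (cmin * Real.sqrt cmin) * r ^ 2 * Real.exp (r * L) - 4 * Real.sqrt c₁ ∧
      ((cmin * Real.sqrt cmin) * r ^ 2 * Real.exp (r * L) > 12 * Real.sqrt c₁ →
        N c₁ r cmin > 0) := by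
  have h_arg : r * (Real.sqrt cmin - Real.sqrt c₁) = -(r * L) := by rw [hL]; ring
  have h_sinh := exp_div_three_le_sinh hrL
  have h_cosh : Real.exp (r * L) / 3 ≤ Real.cosh (r * L) :=
    h_sinh.trans (Real.sinh_lt_cosh _).le
  have h_sqrt : 0 ≤ Real.sqrt cmin := Real.sqrt_nonneg _
  have h_lower : N c₁ r cmin ≥
      (1 / 3) * (Real.sqrt cmin * (3 + r ^ 2 * cmin) + 3 * cmin * r) * Real.exp (r * L) -
        4 * Real.sqrt c₁ := by
    rw [N, h_arg, Real.cosh_neg, Real.sinh_neg]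
    have h₁ := mul_le_mul_of_nonneg_left h_cosh
      (show 0 ≤ Real.sqrt cmin * (3 + r ^ 2 * cmin) by positivity)
    have h₂ := mul_le_mul_of_nonneg_left h_sinh (show 0 ≤ 3 * cmin * r by positivity)
    linarith
  have h_lead :
      (1 / 3) * (Real.sqrt cmin * (3 + r ^ 2 * cmin) + 3 * cmin * r) * Real.exp (r * L) -
          4 * Real.sqrt c₁ ≥
        (1 / 3) * (cmin * Real.sqrt cmin) * r ^ 2 * Real.exp (r * L) - 4 * Real.sqrt c₁ := by
    have h : 0 ≤ (Real.sqrt cmin + cmin * r) * Real.exp (r * L) := by positivity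
    linarith
  exact ⟨h_lower, h_lead, fun h => by linarith⟩
end

section
/- Let 0 < c₁ < c₂, set M := √c₂ − √c₁, and let r > 0 satisfy r > 3/√c₂ and M·r ≥ log(2·√c₂/√c₁). Then there exists c₃* in the open interval (c₁, c₂) at which the derivative of J(c₃) := D(c₁, c₃; r) + D(c₂, c₃; r) vanishes. -/
/-- The distance to a basepoint of curvature parameter `a ^ 2`, as a function of `s = √c₃`. -/
noncomputable def sqrtDist (a r s : ℝ) : ℝ :=
  (-a + 2 * s * Real.cosh ((s - a) * r)) / (2 * a * s ^ 2)

/-- The derivative of `sqrtDist a r`. -/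
noncomputable def sqrtDistDeriv (a r s : ℝ) : ℝ :=
  1 / s ^ 3 + (r * s * Real.sinh ((s - a) * r) - Real.cosh ((s - a) * r)) / (a * s ^ 2)

theorem hasDerivAt_sqrtDist {a s : ℝ} (r : ℝ) (ha : a ≠ 0) (hs : s ≠ 0) :
    HasDerivAt (sqrtDist a r) (sqrtDistDeriv a r s) s := by
  have hlin : HasDerivAt (fun s : ℝ => (s - a) * r) (1 * r) s :=
    ((hasDerivAt_id s).sub_const a).mul_const r
  have hnum := (((hasDerivAt_id s).const_mul 2).mul hlin.cosh).const_add (-a)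
  have hden := (hasDerivAt_pow 2 s).const_mul (2 * a)
  have hne : 2 * a * s ^ 2 ≠ 0 := by positivity
  refine (hnum.div hden hne).congr_deriv ?_
  simp only [sqrtDistDeriv, id, Pi.mul_apply]
  field_simp
  push_cast
  ring

theorem D_eq_sqrtDist {x : ℝ} (c r : ℝ) (hx : 0 ≤ x) :
    D c r x = sqrtDist (Real.sqrt c) r (Real.sqrt x) := by
  rw [D, sqrtDist, Real.sq_sqrt hx]

theorem sqrtDistDeriv_add_neg {a b r : ℝ} (ha : 0 < a) (hab : a < b) (hr : 0 < r)
    (h : Real.log (2 * b / a) ≤ (b - a) * r) :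
    sqrtDistDeriv a r a + sqrtDistDeriv b r a < 0 := by
  have hb : 0 < b := ha.trans hab
  have hexp : 2 * b / a ≤ Real.exp ((b - a) * r) := (Real.log_le_iff_le_exp (by positivity)).1 h
  have hcosh : b / a < Real.cosh ((b - a) * r) := by
    rw [Real.cosh_eq]
    have := Real.exp_pos (-((b - a) * r))
    have h2 : 2 * b / a = 2 * (b / a) := by ring
    linarith
  have hsinh : 0 < Real.sinh ((b - a) * r) :=
    Real.sinh_pos_iff.2 (mul_pos (sub_pos.2 hab) hr)
  have hneg : (a - b) * r = -((b - a) * r) := by ring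
  have hprod : 0 < r * a * Real.sinh ((b - a) * r) := by positivity
  rw [div_lt_iff₀ ha] at hcosh
  have key : sqrtDistDeriv a r a + sqrtDistDeriv b r a =
      (b - Real.cosh ((b - a) * r) * a - a * (r * a * Real.sinh ((b - a) * r))) / (a ^ 3 * b) := by
    simp only [sqrtDistDeriv, hneg, sub_self, zero_mul, Real.sinh_neg, Real.cosh_neg,
      Real.sinh_zero, Real.cosh_zero]
    field_simp
    ring
  rw [key]
  refine div_neg_of_neg_of_pos ?_ (by positivity)
  have := mul_pos ha hprod
  linarith

theorem sqrtDistDeriv_add_pos {a b r : ℝ} (ha : 0 < a) (hab : a < b) (hrb : 3 < r * b)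
    (h : Real.log (2 * b / a) ≤ (b - a) * r) :
    0 < sqrtDistDeriv a r b + sqrtDistDeriv b r b := by
  have hb : 0 < b := ha.trans hab
  have hexp : 2 * b / a ≤ Real.exp ((b - a) * r) := (Real.log_le_iff_le_exp (by positivity)).1 h
  have htwo : 2 < Real.exp ((b - a) * r) := by
    refine lt_of_lt_of_le ?_ hexp
    rw [lt_div_iff₀ ha]
    linarith
  have hinv : Real.exp (-((b - a) * r)) < 1 / 2 := by
    rw [Real.exp_neg, ← one_div]
    exact one_div_lt_one_div_of_lt two_pos htwo
  have hsinh : 0 < Real.sinh ((b - a) * r) := by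
    rw [Real.sinh_eq]
    linarith
  have hcosh : Real.cosh ((b - a) * r) < 3 * Real.sinh ((b - a) * r) := by
    rw [Real.sinh_eq, Real.cosh_eq]
    linarith
  have hmul := mul_lt_mul_of_pos_right hrb hsinh
  have key : sqrtDistDeriv a r b + sqrtDistDeriv b r b =
      1 / b ^ 3 + (r * b * Real.sinh ((b - a) * r) - Real.cosh ((b - a) * r)) / (a * b ^ 2) := by
    simp only [sqrtDistDeriv, sub_self, zero_mul, Real.sinh_zero, Real.cosh_zero]
    field_simp
    ring
  rw [key]
  have : 0 < r * b * Real.sinh ((b - a) * r) - Real.cosh ((b - a) * r) := by linarith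
  positivity

theorem stmt_18 (c₁ c₂ r M : ℝ) (hc₁ : 0 < c₁) (hc : c₁ < c₂)
    (hM : M = Real.sqrt c₂ - Real.sqrt c₁) (hr : 0 < r)
    (hr3 : r > 3 / Real.sqrt c₂)
    (hMr : M * r ≥ Real.log (2 * Real.sqrt c₂ / Real.sqrt c₁)) :
    ∃ c₃star ∈ Set.Ioo c₁ c₂, deriv (fun c₃ => D c₁ r c₃ + D c₂ r c₃) c₃star = 0 := by
  subst hM
  have ha : 0 < Real.sqrt c₁ := Real.sqrt_pos.2 hc₁
  have hab : Real.sqrt c₁ < Real.sqrt c₂ := Real.sqrt_lt_sqrt hc₁.le hc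
  have hb : 0 < Real.sqrt c₂ := ha.trans hab
  have hderiv : ∀ s, 0 < s → HasDerivAt
      (fun s => sqrtDist (Real.sqrt c₁) r s + sqrtDist (Real.sqrt c₂) r s)
      (sqrtDistDeriv (Real.sqrt c₁) r s + sqrtDistDeriv (Real.sqrt c₂) r s) s := fun s hs =>
    (hasDerivAt_sqrtDist r ha.ne' hs.ne').add (hasDerivAt_sqrtDist r hb.ne' hs.ne')
  obtain ⟨s, ⟨has, hsb⟩, hs⟩ := exists_hasDerivWithinAt_eq_of_gt_of_lt hab.le
    (fun s hs => (hderiv s (ha.trans_le hs.1)).hasDerivWithinAt)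
    (sqrtDistDeriv_add_neg ha hab hr hMr)
    (sqrtDistDeriv_add_pos ha hab ((div_lt_iff₀ hb).1 hr3) hMr)
  have hs0 : 0 < s := ha.trans has
  have hsq : Real.sqrt (s ^ 2) = s := Real.sqrt_sq hs0.le
  refine ⟨s ^ 2, ⟨(Real.sqrt_lt' hs0).1 has, (Real.lt_sqrt hs0.le).1 hsb⟩, ?_⟩
  have hcomp := HasDerivAt.comp (s ^ 2) (by rw [hsq]; exact hderiv s hs0)
    (Real.hasDerivAt_sqrt (pow_pos hs0 2).ne')
  have heq : (fun c₃ => D c₁ r c₃ + D c₂ r c₃) =ᶠ[nhds (s ^ 2)]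
      (fun s => sqrtDist (Real.sqrt c₁) r s + sqrtDist (Real.sqrt c₂) r s) ∘ Real.sqrt := by
    filter_upwards [lt_mem_nhds (pow_pos hs0 2)] with x hx
    simp only [Function.comp, D_eq_sqrtDist _ r hx.le]
  rw [heq.deriv_eq, hcomp.deriv]
  exact mul_eq_zero_of_left hs _
end
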